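/- Suppose F ∈ K((t)) is a nonzero solution of E(Δ,t)F = 0 where E(Δ,t) = NΔ^m - Σ_{j=1}^m P_j Δ^{m-j} with S = deg N ≥ 0, deg P_m = S+1, deg P_j < S+1 for j < m. Then the derivatives Δ^0 F, Δ^1 F, ..., Δ^{m-1} F are linearly independent over K(t). -/

import Mathlib

open Polynomial

/-- The Euler operator `Δ = t·d/dt` on `K((t))`: `Δ(Σ aₙ tⁿ) = Σ n aₙ tⁿ`. -/
noncomputable def eulerOp (K : Type*) [Field K] (f : LaurentSeries K) : LaurentSeries K :=
  ⟨fun n => (n : K) * f.coeff n,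
    f.isPWO_support'.mono fun n hn => by
      simp only [Function.mem_support] at hn ⊢
      exact right_ne_zero_of_mul hn⟩

namespace EulerAux

variable {K : Type*} [Field K]

/-- inclusion of polynomials in Laurent series -/
noncomputable def iota (K : Type*) [Field K] : K[X] →+* LaurentSeries K :=
  (HahnSeries.ofPowerSeries ℤ K).comp Polynomial.coeToPowerSeries.ringHom

lemma iota_apply (p : K[X]) : iota K p = ((p : PowerSeries K) : LaurentSeries K) := rfl

lemma iota_monomial (n : ℕ) (a : K) : iota K (monomial n a) = HahnSeries.single (n : ℤ) a := by
  rw [← C_mul_X_pow_eq_monomial, iota_apply]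
  simp [HahnSeries.ofPowerSeries_C, HahnSeries.C_apply]

lemma iota_injective : Function.Injective (iota K) := by
  intro p q h
  exact Polynomial.coe_injective K (HahnSeries.ofPowerSeries_injective h)

/-- Euler operator as additive endomorphism -/
noncomputable def eul (K : Type*) [Field K] : AddMonoid.End (LaurentSeries K) where
  toFun := eulerOp K
  map_zero' := by ext n; simp [eulerOp]
  map_add' x y := by ext n; simp [eulerOp, mul_add]

lemma eul_coeff (f : LaurentSeries K) (n : ℤ) : (eul K f).coeff n = (n : K) * f.coeff n := rfl

lemma eul_pow (k : ℕ) (f : LaurentSeries K) : (eul K ^ k) f = (eulerOp K)^[k] f := by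
  rw [AddMonoid.End.coe_pow]; rfl

/-- Euler derivation on polynomials -/
noncomputable def del (K : Type*) [Field K] : K[X] →+ K[X] where
  toFun p := X * derivative p
  map_zero' := by simp
  map_add' x y := by simp [mul_add]

lemma del_coeff (p : K[X]) (n : ℕ) : (del K p).coeff n = (n : K) * p.coeff n := by
  change (X * derivative p).coeff n = _
  cases n with
  | zero => simp
  | succ n => rw [coeff_X_mul, coeff_derivative]; push_cast; ring

lemma del_monomial (n : ℕ) (a : K) : del K (monomial n a) = monomial n ((n : K) * a) := by
  ext k
  rw [del_coeff, coeff_monomial, coeff_monomial]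
  split_ifs with h
  · rw [h]
  · simp

lemma leibniz (p : K[X]) (f : LaurentSeries K) :
    eul K (iota K p * f) = iota K (del K p) * f + iota K p * eul K f := by
  induction p using Polynomial.induction_on' with
  | add p q hp hq => simp only [map_add, add_mul, hp, hq]; abel
  | monomial n a =>
    rw [del_monomial, iota_monomial, iota_monomial]
    ext k
    simp only [eul_coeff, HahnSeries.coeff_add, HahnSeries.coeff_single_mul]
    push_cast
    ring

/-- the operator attached to a polynomial in `Δ` with coefficients in `K[t]` -/
noncomputable def op (A : K[X][X]) : AddMonoid.End (LaurentSeries K) :=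
  A.eval₂ ((Module.toAddMonoidEnd (LaurentSeries K) (LaurentSeries K)).comp (iota K)) (eul K)

lemma op_monomial (n : ℕ) (a : K[X]) (f : LaurentSeries K) :
    op (monomial n a) f = iota K a * (eul K ^ n) f := by
  rw [op, eval₂_monomial]; rfl

lemma op_add (A B : K[X][X]) (f : LaurentSeries K) : op (A + B) f = op A f + op B f := by
  rw [op, eval₂_add]; rfl

/-- `op` at fixed argument -/
noncomputable def opAt (f : LaurentSeries K) : K[X][X] →+ LaurentSeries K :=
  AddMonoidHom.mk' (fun A => op A f) (fun A B => op_add A B f)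

lemma opAt_monomial (n : ℕ) (a : K[X]) (f : LaurentSeries K) :
    opAt f (monomial n a) = iota K a * (eul K ^ n) f := op_monomial n a f

lemma opAt_C_mul (f : LaurentSeries K) (a : K[X]) (A : K[X][X]) :
    opAt f (C a * A) = iota K a * opAt f A := by
  induction A using Polynomial.induction_on' with
  | add p q hp hq => simp only [map_add, mul_add, hp, hq]
  | monomial n b => rw [C_mul_monomial, opAt_monomial, opAt_monomial, map_mul, mul_assoc]

/-- coefficientwise derivation -/
noncomputable def cdel (A : K[X][X]) : K[X][X] := 
  ∑ i ∈ A.support, monomial i (del K (A.coeff i))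

lemma cdel_coeff (A : K[X][X]) (n : ℕ) : (cdel A).coeff n = del K (A.coeff n) := by
  unfold cdel
  simp only [finsetSum_coeff, coeff_monomial]
  rw [Finset.sum_ite_eq']
  split_ifs with h
  · rfl
  · rw [notMem_support_iff.mp h, map_zero]

/-- left composition with `Δ` -/
noncomputable def D (K : Type*) [Field K] : AddMonoid.End K[X][X] where
  toFun A := X * A + cdel A
  map_zero' := by ext n : 1; simp [cdel_coeff]
  map_add' x y := by ext n : 1; simp [cdel_coeff, mul_add]; ring

lemma D_apply (A : K[X][X]) : D K A = X * A + cdel A := rfl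

lemma cdel_monomial (n : ℕ) (a : K[X]) : cdel (monomial n a) = monomial n (del K a) := by
  ext k : 1
  rw [cdel_coeff, coeff_monomial, coeff_monomial]
  split_ifs <;> simp

lemma opAt_D (f : LaurentSeries K) (A : K[X][X]) : opAt f (D K A) = eul K (opAt f A) := by
  induction A using Polynomial.induction_on' with
  | add p q hp hq => simp only [map_add, hp, hq]
  | monomial n b =>
    rw [D_apply, cdel_monomial, X_mul_monomial, map_add, opAt_monomial, opAt_monomial,
      opAt_monomial, leibniz, pow_succ', add_comm]
    rfl

lemma D_pow_succ (A : K[X][X]) (k : ℕ) : (D K ^ (k+1)) A = D K ((D K ^ k) A) := by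
  rw [AddMonoid.End.coe_pow, Function.iterate_succ_apply', ← AddMonoid.End.coe_pow]

lemma opAt_D_pow (f : LaurentSeries K) (A : K[X][X]) (h : opAt f A = 0) (k : ℕ) :
    opAt f ((D K ^ k) A) = 0 := by
  induction k with
  | zero => simpa using h
  | succ k ih =>
    rw [D_pow_succ, opAt_D, ih, map_zero]

lemma D_pow_coeff (A : K[X][X]) (r : ℕ) (hA : A.natDegree ≤ r) (k : ℕ) :
    ((D K ^ k) A).natDegree ≤ r + k ∧ ((D K ^ k) A).coeff (r + k) = A.coeff r := by
  induction k with
  | zero => simpa using hA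
  | succ k ih =>
    obtain ⟨h1, h2⟩ := ih
    rw [D_pow_succ]
    have hz : ∀ n, r + k < n → ((D K ^ k) A).coeff n = 0 := fun n hn =>
      coeff_eq_zero_of_natDegree_lt (by omega)
    constructor
    · rw [natDegree_le_iff_coeff_eq_zero]
      intro n hn
      obtain ⟨n, rfl⟩ : ∃ n', n = n' + 1 := ⟨n - 1, by omega⟩
      rw [D_apply, coeff_add, coeff_X_mul, cdel_coeff, hz n (by omega), hz (n+1) (by omega)]
      simp
    · rw [← add_assoc, D_apply, coeff_add, coeff_X_mul, cdel_coeff, hz (r+k+1) (by omega), h2]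
      simp

/-- composition of operators -/
noncomputable def comp (Q : K[X][X]) (R : K[X][X]) : K[X][X] :=
  R.sum fun k c => C c * (D K ^ k) Q

lemma comp_add (Q R S : K[X][X]) : comp Q (R + S) = comp Q R + comp Q S := by
  unfold comp
  rw [sum_add_index]
  · simp
  · intro i a b; simp [add_mul]

lemma comp_monomial (Q : K[X][X]) (k : ℕ) (c : K[X]) :
    comp Q (monomial k c) = C c * (D K ^ k) Q := by
  unfold comp
  rw [sum_monomial_index]; simp

lemma division (f : LaurentSeries K) (Q : K[X][X]) (hQ : Q ≠ 0) (hQf : opAt f Q = 0)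
    (hmin : ∀ A : K[X][X], A ≠ 0 → opAt f A = 0 → Q.natDegree ≤ A.natDegree) (d : ℕ) :
    ∀ A : K[X][X], opAt f A = 0 → A.natDegree < d →
      ∃ a : K[X], a ≠ 0 ∧ ∃ R : K[X][X], (∀ k, R.coeff k ≠ 0 → k + Q.natDegree < d) ∧
        C a * A = comp Q R := by
  induction d with
  | zero => intro A _ h; omega
  | succ d ih =>
    intro A hA hd
    by_cases hA0 : A = 0
    · exact ⟨1, one_ne_zero, 0, by simp, by simp [hA0, comp]⟩
    have hr := hmin A hA0 hA
    have hrd : Q.natDegree ≤ d := by omega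
    obtain ⟨h1, h2⟩ := D_pow_coeff Q Q.natDegree le_rfl (d - Q.natDegree)
    rw [Nat.add_sub_cancel' hrd] at h1 h2
    set q := Q.coeff Q.natDegree with hq
    have hq0 : q ≠ 0 := by simpa [hq] using hQ
    set B := C q * A - C (A.coeff d) * (D K ^ (d - Q.natDegree)) Q with hB
    have hBf : opAt f B = 0 := by
      rw [hB, map_sub, opAt_C_mul, opAt_C_mul, hA, opAt_D_pow f Q hQf]; simp
    have hBc : ∀ n, d ≤ n → B.coeff n = 0 := by
      intro n hn
      rw [hB, coeff_sub, coeff_C_mul, coeff_C_mul]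
      rcases hn.eq_or_lt with rfl | hn
      · rw [h2]; ring
      · rw [coeff_eq_zero_of_natDegree_lt (lt_of_lt_of_le hd hn),
          coeff_eq_zero_of_natDegree_lt (lt_of_le_of_lt h1 hn)]; ring
    obtain ⟨a, ha, R, hR, hRe⟩ : ∃ a : K[X], a ≠ 0 ∧ ∃ R : K[X][X],
        (∀ k, R.coeff k ≠ 0 → k + Q.natDegree < d) ∧ C a * B = comp Q R := by
      by_cases hB0 : B = 0
      · exact ⟨1, one_ne_zero, 0, by simp, by simp [hB0, comp]⟩
      · apply ih B hBf
        by_contra hcon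
        exact hB0 (leadingCoeff_eq_zero.mp (hBc _ (not_lt.mp hcon)))
    refine ⟨a * q, mul_ne_zero ha hq0, R + monomial (d - Q.natDegree) (a * A.coeff d), ?_, ?_⟩
    · intro k hk
      by_contra hcon
      apply hk
      rw [coeff_add, coeff_monomial, if_neg (by omega)]
      by_contra h
      have := hR k (by simpa using h)
      omega
    · rw [comp_add, comp_monomial, ← hRe, hB, C_mul, C_mul]; ring

/-- the weight substitution `t ↦ z^m`, `Δ ↦ zY` -/
noncomputable def phi (K : Type*) [Field K] (m : ℕ) : K[X][X] →+* K[X][X] :=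
  eval₂RingHom (eval₂RingHom (C.comp C) (X ^ m)) (X * C X)

lemma phi_monomial (m i j : ℕ) (c : K) :
    phi K m (monomial i (monomial j c)) = monomial (m * j + i) (monomial i c) := by
  simp only [phi, coe_eval₂RingHom, eval₂_monomial]
  rw [← C_mul_X_pow_eq_monomial, ← C_mul_X_pow_eq_monomial, C_mul, C_pow]
  simp only [RingHom.comp_apply]
  ring

lemma phi_coeff (m : ℕ) (hm : 0 < m) (A : K[X][X]) (i j : ℕ) :
    ((phi K m A).coeff (m * j + i)).coeff i = (A.coeff i).coeff j := by
  induction A using Polynomial.induction_on' with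
  | add p q hp hq => simp only [map_add, coeff_add, hp, hq]
  | monomial n b =>
    induction b using Polynomial.induction_on' with
    | add p q hp hq => simp only [map_add, coeff_add, hp, hq]
    | monomial k c =>
      rw [phi_monomial, coeff_monomial, coeff_monomial]
      by_cases h : n = i
      · subst h
        by_cases h' : k = j
        · subst h'; simp
        · rw [if_neg, if_pos rfl, coeff_monomial, if_neg h', coeff_zero]
          intro h2
          exact h' (Nat.eq_of_mul_eq_mul_left hm (Nat.add_right_cancel h2))
      · rw [if_neg h]
        split_ifs
        · rw [coeff_monomial, if_neg h, coeff_zero]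
        · simp

lemma phi_coeff_zero (m : ℕ) (A : K[X][X]) (i n : ℕ) (h : ∀ j, n ≠ m * j + i) :
    ((phi K m A).coeff n).coeff i = 0 := by
  induction A using Polynomial.induction_on' with
  | add p q hp hq => simp only [map_add, coeff_add, hp, hq, add_zero]
  | monomial l b =>
    induction b using Polynomial.induction_on' with
    | add p q hp hq => simp only [map_add, coeff_add, hp, hq, add_zero]
    | monomial k c =>
      rw [phi_monomial, coeff_monomial]
      split_ifs with h1
      · rw [coeff_monomial, if_neg]
        rintro rfl
        exact h k h1.symm
      · simp

lemma phi_degree_lt (m : ℕ) (hm : 0 < m) (A : K[X][X]) (w : ℕ) :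
    (phi K m A).degree < w ↔ ∀ i j, w ≤ m * j + i → (A.coeff i).coeff j = 0 := by
  rw [degree_lt_iff_coeff_zero]
  constructor
  · intro h i j hw
    rw [← phi_coeff m hm, h _ hw, coeff_zero]
  · intro h n hn
    ext i
    rw [coeff_zero]
    by_cases hj : ∃ j, n = m * j + i
    · obtain ⟨j, rfl⟩ := hj
      rw [phi_coeff m hm]
      exact h i j hn
    · push Not at hj
      exact phi_coeff_zero m A i n hj

lemma phi_ne_zero (m : ℕ) (hm : 0 < m) (A : K[X][X]) (hA : A ≠ 0) : phi K m A ≠ 0 := by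
  intro h
  apply hA
  ext i j
  rw [← phi_coeff m hm, h]; simp

lemma D_pow_weight (m : ℕ) (hm : 0 < m) (Q : K[X][X]) (w : ℕ)
    (hw : (phi K m Q).degree < (w + 1 : ℕ)) (k : ℕ) :
    (phi K m ((D K ^ k) Q)).degree < (w + k + 1 : ℕ) ∧
      (phi K m ((D K ^ k) Q - X ^ k * Q)).degree < (w + k : ℕ) := by
  have hX : ∀ (A : K[X][X]) (v : ℕ), (phi K m A).degree < v →
      (phi K m (X * A)).degree < (v + 1 : ℕ) := by
    intro A v h
    rw [phi_degree_lt m hm] at h ⊢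
    intro i j hij
    cases i with
    | zero => simp
    | succ i => rw [coeff_X_mul]; exact h i j (by omega)
  have hc : ∀ (A : K[X][X]) (v : ℕ), (phi K m A).degree < v →
      (phi K m (cdel A)).degree < (v : ℕ) := by
    intro A v h
    rw [phi_degree_lt m hm] at h ⊢
    intro i j hij
    rw [cdel_coeff, del_coeff, h i j hij, mul_zero]
  have hadd : ∀ (A B : K[X][X]) (v : ℕ), (phi K m A).degree < v → (phi K m B).degree < v →
      (phi K m (A + B)).degree < (v : ℕ) := by
    intro A B v h1 h2
    rw [map_add]
    exact lt_of_le_of_lt (degree_add_le _ _) (max_lt h1 h2)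
  induction k with
  | zero =>
    refine ⟨by simpa using hw, ?_⟩
    simp only [pow_zero, AddMonoid.End.coe_one, id_eq, one_mul, sub_self, map_zero, degree_zero]
    exact WithBot.bot_lt_coe _
  | succ k ih =>
    obtain ⟨h1, h2⟩ := ih
    rw [D_pow_succ, D_apply]
    constructor
    · apply hadd
      · exact hX _ _ h1
      · exact lt_of_lt_of_le (hc _ _ h1) (by exact_mod_cast Nat.le_succ _)
    · have : X * (D K ^ k) Q + cdel ((D K ^ k) Q) - X ^ (k+1) * Q =
        X * ((D K ^ k) Q - X ^ k * Q) + cdel ((D K ^ k) Q) := by ring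
      rw [this]
      apply hadd
      · exact hX _ _ h2
      · exact hc _ _ h1

lemma comp_weight (m : ℕ) (hm : 0 < m) (Q R : K[X][X]) (w v : ℕ)
    (hw : (phi K m Q).degree < (w + 1 : ℕ)) (hv : (phi K m R).degree < (v + 1 : ℕ)) :
    (phi K m (comp Q R - R * Q)).degree < (w + v : ℕ) := by
  have h : comp Q R - R * Q = ∑ k ∈ R.support, C (R.coeff k) * ((D K ^ k) Q - X ^ k * Q) := by
    have hR : R * Q = ∑ k ∈ R.support, C (R.coeff k) * (X ^ k * Q) := by
      conv_lhs => rw [R.as_sum_support_C_mul_X_pow, Finset.sum_mul]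
      exact Finset.sum_congr rfl fun k _ => mul_assoc _ _ _
    rw [hR]
    simp only [mul_sub, Finset.sum_sub_distrib]
    rfl
  rw [h, map_sum, ← mem_degreeLT]
  apply Submodule.sum_mem
  intro k _
  rw [mem_degreeLT, map_mul]
  have h2 := (D_pow_weight m hm Q w hw k).2
  by_cases hz : phi K m ((D K ^ k) Q - X ^ k * Q) = 0
  · rw [hz, mul_zero, degree_zero]; exact WithBot.bot_lt_coe _
  by_cases hz' : phi K m (C (R.coeff k)) = 0
  · rw [hz', zero_mul, degree_zero]; exact WithBot.bot_lt_coe _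
  by_cases hkv : k ≤ v
  · have h3 : (phi K m (C (R.coeff k))).degree < (v - k + 1 : ℕ) := by
      rw [phi_degree_lt m hm] at hv ⊢
      intro i j hij
      rw [coeff_C]
      split_ifs with hi
      · exact hv k j (by omega)
      · simp
    rw [degree_mul, degree_eq_natDegree hz, degree_eq_natDegree hz']
    rw [degree_eq_natDegree hz] at h2
    rw [degree_eq_natDegree hz'] at h3
    norm_cast at h2 h3 ⊢
    omega
  · exfalso
    apply hz'
    rw [← degree_eq_bot, ← Nat.WithBot.lt_zero_iff]
    have : ((0 : ℕ) : WithBot ℕ) = 0 := rfl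
    rw [← this, phi_degree_lt m hm]
    intro i j _
    rw [phi_degree_lt m hm] at hv
    rw [coeff_C]
    split_ifs with hi
    · exact hv k j (by omega)
    · simp

lemma phi_lead_monomial (m : ℕ) (A : K[X][X]) (hA : ∀ i, m ≤ i → A.coeff i = 0)
    (hm : 0 < m) (n : ℕ) : ∃ i c, (phi K m A).coeff n = monomial i c := by
  refine ⟨n % m, ((phi K m A).coeff n).coeff (n % m), ?_⟩
  ext i
  rw [coeff_monomial]
  split_ifs with h
  · rw [h]
  · by_cases hj : ∃ j, n = m * j + i
    · obtain ⟨j, rfl⟩ := hj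
      rw [phi_coeff m hm, hA i, coeff_zero]
      by_contra hi
      apply h
      rw [Nat.mul_add_mod, Nat.mod_eq_of_lt (by omega)]
    · push Not at hj
      exact phi_coeff_zero m A i n hj

lemma no_factor (m : ℕ) (hm : 0 < m) (Q R L : K[X][X]) (a : K[X]) (ha : a ≠ 0)
    (hQ : ∀ i, m ≤ i → Q.coeff i = 0) (hR : ∀ i, m ≤ i → R.coeff i = 0)
    (s : ℕ) (hL : (phi K m L).degree < (m * (s + 1) + 1 : ℕ))
    (h0 : (L.coeff 0).coeff (s + 1) ≠ 0) (h1 : (L.coeff m).coeff s ≠ 0)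
    (h : C a * L = comp Q R) : False := by
  have hL0 : L ≠ 0 := by rintro rfl; simp at h0
  have hQ0 : Q ≠ 0 := by
    rintro rfl
    have : comp (0 : K[X][X]) R = 0 := by simp [comp, Polynomial.sum]
    rw [this] at h
    exact mul_ne_zero (C_ne_zero.mpr ha) hL0 h
  have hR0 : R ≠ 0 := by
    rintro rfl
    have : comp Q 0 = 0 := by simp [comp]
    rw [this] at h
    exact mul_ne_zero (C_ne_zero.mpr ha) hL0 h
  have hpQ := phi_ne_zero m hm Q hQ0
  have hpR := phi_ne_zero m hm R hR0
  have hpa := phi_ne_zero m hm (C a) (C_ne_zero.mpr ha)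
  have hw := comp_weight m hm Q R (phi K m Q).natDegree (phi K m R).natDegree
    (by rw [degree_eq_natDegree hpQ]; exact_mod_cast Nat.lt_succ_self _)
    (by rw [degree_eq_natDegree hpR]; exact_mod_cast Nat.lt_succ_self _)
  have hlt : (phi K m (comp Q R - R * Q)).degree < (phi K m R * phi K m Q).degree := by
    rw [degree_mul, degree_eq_natDegree hpQ, degree_eq_natDegree hpR, add_comm]
    exact_mod_cast hw
  have hlc : (phi K m (C a * L)).leadingCoeff
      = (phi K m R).leadingCoeff * (phi K m Q).leadingCoeff := by
    have : phi K m (C a * L) = phi K m (comp Q R - R * Q) + phi K m R * phi K m Q := by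
      rw [h, map_sub, map_mul]; ring
    rw [this, leadingCoeff_add_of_degree_lt hlt, leadingCoeff_mul]
  rw [map_mul, leadingCoeff_mul] at hlc
  obtain ⟨i1, c1, e1⟩ := phi_lead_monomial m Q hQ hm (phi K m Q).natDegree
  obtain ⟨i2, c2, e2⟩ := phi_lead_monomial m R hR hm (phi K m R).natDegree
  obtain ⟨i3, c3, e3⟩ := phi_lead_monomial m (C a)
    (fun i hi => by rw [coeff_C, if_neg (by omega)]) hm (phi K m (C a)).natDegree
  have hc3 : c3 ≠ 0 := by
    rintro rfl
    apply hpa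
    rw [← leadingCoeff_eq_zero]
    simpa using e3
  have hLc0 : ((phi K m L).coeff (m * (s + 1))).coeff 0 ≠ 0 := by
    have := phi_coeff m hm L 0 (s+1)
    rw [add_zero] at this
    rwa [this]
  have hLcm : ((phi K m L).coeff (m * (s + 1))).coeff m ≠ 0 := by
    have := phi_coeff m hm L m s
    rw [← Nat.mul_succ] at this
    rwa [this]
  have hnd : (phi K m L).natDegree = m * (s + 1) := by
    apply le_antisymm
    · exact Nat.lt_succ_iff.mp ((natDegree_lt_iff_degree_lt (phi_ne_zero m hm L hL0)).mpr hL)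
    · apply le_natDegree_of_ne_zero
      intro h; rw [h] at hLc0; simp at hLc0
  simp only [leadingCoeff] at hlc
  rw [hnd, e1, e2, e3, monomial_mul_monomial] at hlc
  have k0 := congrArg (fun p => p.coeff (0 + i3)) hlc
  have k1 := congrArg (fun p => p.coeff (m + i3)) hlc
  simp only [coeff_monomial_mul, coeff_monomial] at k0 k1
  split_ifs at k0 k1 with g0 g1
  · omega
  · exact mul_ne_zero hc3 hLcm k1
  · exact mul_ne_zero hc3 hLc0 k0
  · exact mul_ne_zero hc3 hLc0 k0

end EulerAux

/-- **Condition B\* for `E(Δ,t)` (proof of Corollary 4.1).** Suppose `F ∈ K((t))` is a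
nonzero solution of `E(Δ,t)F = 0` where `E(Δ,t) = NΔ^m - Σ_{j=1}^m P_j Δ^{m-j}` with
`S = deg N ≥ 0`, `deg P_m = S+1`, `deg P_j < S+1` for `j < m`. Then
`Δ⁰F, Δ¹F, …, Δ^{m-1}F` are linearly independent over `K(t)` (equivalently, over `K[t]`).
(`P j` with `j : Fin m` stands for `P_{j+1}`.) -/
theorem stmt18 (K : Type*) [Field K] [CharZero K]
    (m : ℕ) (hm : 2 ≤ m)
    (N : Polynomial K) (P : Fin m → Polynomial K)
    (hN : N ≠ 0)
    (hPm : (P ⟨m - 1, by omega⟩).degree = N.degree + 1)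
    (hPj : ∀ j : Fin m, (j : ℕ) + 1 < m → (P j).degree < N.degree + 1)
    (F : LaurentSeries K) (hF : F ≠ 0)
    (heq : ((N : PowerSeries K) : LaurentSeries K) * (eulerOp K)^[m] F =
      ∑ j : Fin m, ((P j : PowerSeries K) : LaurentSeries K)
        * (eulerOp K)^[m - 1 - (j : ℕ)] F) :
    ∀ c : Fin m → Polynomial K,
      (∑ i : Fin m, ((c i : PowerSeries K) : LaurentSeries K) * (eulerOp K)^[(i : ℕ)] F = 0) →
      ∀ i : Fin m, c i = 0 := by
  intro c hc
  by_contra hne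
  push Not at hne
  obtain ⟨i0, hi0⟩ := hne
  classical
  have hcoef : ∀ (b : Fin m → K[X]) (i : ℕ) (hi : i < m),
      (∑ k : Fin m, monomial (k : ℕ) (b k)).coeff i = b ⟨i, hi⟩ := by
    intro b i hi
    rw [finsetSum_coeff, Finset.sum_eq_single ⟨i, hi⟩]
    · simp
    · intro k _ hk
      rw [coeff_monomial, if_neg]
      intro h; exact hk (Fin.ext h)
    · simp
  have hcoef' : ∀ (b : Fin m → K[X]) (i : ℕ) (hi : m ≤ i),
      (∑ k : Fin m, monomial (k : ℕ) (b k)).coeff i = 0 := by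
    intro b i hi
    rw [finsetSum_coeff]
    apply Finset.sum_eq_zero
    intro k _
    rw [coeff_monomial, if_neg]
    have := k.2
    omega
  have hex : ∃ n, ∃ Q : K[X][X], Q ≠ 0 ∧ EulerAux.opAt F Q = 0 ∧ Q.natDegree = n ∧ n < m := by
    refine ⟨_, ∑ k : Fin m, monomial (k : ℕ) (c k), ?_, ?_, rfl, ?_⟩
    · intro h
      apply hi0
      have := hcoef c i0 i0.2
      rw [h] at this
      simpa using this.symm
    · rw [map_sum, ← hc]
      refine Finset.sum_congr rfl fun k _ => ?_
      rw [EulerAux.opAt_monomial, EulerAux.eul_pow]; rfl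
    · have : (∑ k : Fin m, monomial (k : ℕ) (c k)).natDegree ≤ m - 1 := by
        rw [natDegree_le_iff_coeff_eq_zero]
        intro n hn
        exact hcoef' c n (by omega)
      omega
  obtain ⟨Q, hQ0, hQF, hQn, hQm⟩ := Nat.find_spec hex
  have hmin : ∀ A : K[X][X], A ≠ 0 → EulerAux.opAt F A = 0 → Q.natDegree ≤ A.natDegree := by
    intro A hA hAF
    rw [hQn]
    by_cases hAm : A.natDegree < m
    · exact Nat.find_min' hex ⟨A, hA, hAF, rfl, hAm⟩
    · omega
  rw [← hQn] at hQm
  have hQpos : 0 < Q.natDegree := by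
    by_contra h
    have h0 : Q.natDegree = 0 := by omega
    rw [natDegree_eq_zero] at h0
    obtain ⟨q, rfl⟩ := h0
    rw [← monomial_zero_left, EulerAux.opAt_monomial] at hQF
    rcases mul_eq_zero.mp hQF with h | h
    · apply hQ0
      rw [EulerAux.iota_injective (h.trans (map_zero _).symm), C_0]
    · exact hF (by simpa using h)
  set b : Fin m → K[X] := fun i => P ⟨m - 1 - i, by have := i.2; omega⟩ with hb
  set L : K[X][X] := monomial m N - ∑ k : Fin m, monomial (k : ℕ) (b k) with hLdef
  have hLF : EulerAux.opAt F L = 0 := by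
    rw [hLdef, map_sub, map_sum, EulerAux.opAt_monomial, EulerAux.eul_pow, EulerAux.iota_apply,
      heq, sub_eq_zero, ← Equiv.sum_comp Fin.revPerm]
    refine Finset.sum_congr rfl fun k _ => ?_
    have hk := k.2
    rw [EulerAux.opAt_monomial, EulerAux.eul_pow, EulerAux.iota_apply]
    have e1 : (Fin.revPerm k) = (⟨m - 1 - k, by omega⟩ : Fin m) := by
      ext; simp [Fin.val_rev]; omega
    have e2 : m - 1 - ((Fin.revPerm k : Fin m) : ℕ) = k := by rw [e1]; simp; omega
    rw [e2, e1]
  have hLm : L.coeff m = N := by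
    rw [hLdef, coeff_sub, hcoef' b m le_rfl, coeff_monomial, if_pos rfl, sub_zero]
  have hLi : ∀ i (hi : i < m), L.coeff i = - b ⟨i, hi⟩ := by
    intro i hi
    rw [hLdef, coeff_sub, hcoef b i hi, coeff_monomial, if_neg (by omega), zero_sub]
  have hLbig : ∀ i, m < i → L.coeff i = 0 := by
    intro i hi
    rw [hLdef, coeff_sub, hcoef' b i hi.le, coeff_monomial, if_neg (by omega), sub_zero]
  have hLd : L.natDegree < m + 1 := by
    rw [Nat.lt_succ_iff, natDegree_le_iff_coeff_eq_zero]
    exact fun n hn => hLbig n hn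
  obtain ⟨a, ha, R, hR, hRe⟩ := EulerAux.division F Q hQ0 hQF hmin (m + 1) L hLF hLd
  have hNd := degree_eq_natDegree hN
  rw [hNd] at hPm hPj
  have hPm' : (P ⟨m - 1, by omega⟩).degree = ((N.natDegree + 1 : ℕ) : WithBot ℕ) := by
    rw [hPm]; rfl
  have hPj' : ∀ j : Fin m, (j : ℕ) + 1 < m →
      (P j).degree < ((N.natDegree + 1 : ℕ) : WithBot ℕ) := hPj
  have hb0 : b ⟨0, by omega⟩ = P ⟨m - 1, by omega⟩ := rfl
  refine EulerAux.no_factor m (by omega) Q R L a ha ?_ ?_ N.natDegree ?_ ?_ ?_ hRe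
  · intro i hi
    exact coeff_eq_zero_of_natDegree_lt (by omega)
  · intro i hi
    by_contra h
    have := hR i h
    omega
  · rw [EulerAux.phi_degree_lt m (by omega)]
    intro i j hij
    rcases lt_trichotomy i m with hi | hi | hi
    · rw [hLi i hi, coeff_neg, neg_eq_zero]
      rcases Nat.eq_zero_or_pos i with rfl | hpos
      · rw [hb0]
        apply coeff_eq_zero_of_degree_lt
        rw [hPm']
        have : N.natDegree + 1 < j := by
          by_contra hcon
          have := Nat.mul_le_mul_left m (not_lt.mp hcon)
          omega
        exact_mod_cast this
      · apply coeff_eq_zero_of_degree_lt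
        refine lt_of_lt_of_le (hPj' _ (by simp; omega)) ?_
        have : N.natDegree + 1 ≤ j := by
          by_contra hcon
          have := Nat.mul_le_mul_left m (show j + 1 ≤ N.natDegree + 1 by omega)
          rw [Nat.mul_succ] at this
          omega
        exact_mod_cast this
    · rw [hi, hLm]
      apply coeff_eq_zero_of_natDegree_lt
      by_contra hcon
      have := Nat.mul_le_mul_left m (show j + 1 ≤ N.natDegree + 1 by omega)
      rw [Nat.mul_succ] at this
      omega
    · rw [hLbig i hi, coeff_zero]
  · rw [hLi 0 (by omega), hb0, coeff_neg, neg_ne_zero]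
    exact coeff_ne_zero_of_eq_degree hPm'
  · rw [hLm]
    simpa using hN
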